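/- arXiv:math/0512180 — 2 statements merged into one kernel-verified Lean document; each statement's English description precedes it below -/
import Mathlib

section
/- Let G be a group and Z a subgroup of G contained in the center of G. If G splits as a nontrivial free product with amalgamation A *_C B in which the image of C in G contains Z, then the quotient group G/Z splits as a nontrivial free product with amalgamation (namely (A/Z) *_{C/Z} (B/Z)). Consequently, if Z is central in G and G/Z does not split as a nontrivial free product with amalgamation, then G does not split as a nontrivial free product with amalgamation. -/
/-- A group `G` has Property (FA) if every action of `G` without inversions on a tree
(a connected acyclic simple graph), by graph automorphisms, has a fixed vertex. -/
def HasPropertyFA (G : Type*) [Group G] : Prop :=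
  ∀ (V : Type) (T : SimpleGraph V) (φ : G →* Equiv.Perm V),
    T.Connected → T.IsAcyclic →
    (∀ (g : G) (u v : V), T.Adj u v → T.Adj (φ g u) (φ g v)) →
    (∀ (g : G) (u v : V), T.Adj u v → ¬(φ g u = v ∧ φ g v = u)) →
    ∃ x : V, ∀ g : G, φ g x = x

/-- A witness that `G` is a nontrivial free product with amalgamation `A *_C B`:
injective, non-surjective maps `C → A`, `C → B`, and maps `A → G`, `B → G`
exhibiting `G` as the pushout (via the universal property). -/
structure AmalgamSplitting (G : Type) [Group G] where
  A : Type
  B : Type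
  C : Type
  [groupA : Group A]
  [groupB : Group B]
  [groupC : Group C]
  f : C →* A
  g : C →* B
  ia : A →* G
  ib : B →* G
  f_inj : Function.Injective f
  g_inj : Function.Injective g
  f_not_surj : ¬ Function.Surjective f
  g_not_surj : ¬ Function.Surjective g
  comm : ia.comp f = ib.comp g
  isPushout : ∀ (H : Type) [Group H] (ja : A →* H) (jb : B →* H),
    ja.comp f = jb.comp g → ∃! h : G →* H, h.comp ia = ja ∧ h.comp ib = jb

/-- `G` splits as a nontrivial free product with amalgamation. -/
def SplitsAsNontrivialAmalgam (G : Type) [Group G] : Prop :=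
  Nonempty (AmalgamSplitting G)

namespace Monoid.PushoutI

variable {ι : Type*} {G : ι → Type*} {H : Type*} [∀ i, Group (G i)] [Group H]
  {φ : ∀ i, H →* G i}

/-- `IsReducedProd i j g` says that `g` is the product of a nonempty alternating sequence of
letters outside the base group, the first from `G i` and the last from `G j`. -/
inductive IsReducedProd : ι → ι → PushoutI φ → Prop
  | single {i : ι} (x : G i) (hx : x ∉ (φ i).range) : IsReducedProd i i (of i x)
  | cons {i j k : ι} (x : G i) (hx : x ∉ (φ i).range) (hij : i ≠ j) {g : PushoutI φ}
      (hg : IsReducedProd j k g) : IsReducedProd i k (of i x * g)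

namespace IsReducedProd

theorem append {i j k l : ι} {g g' : PushoutI φ} (hg : IsReducedProd i j g) (hjk : j ≠ k)
    (hg' : IsReducedProd k l g') : IsReducedProd i l (g * g') := by
  induction hg with
  | single x hx => exact cons x hx hjk hg'
  | cons x hx hij _ ih => rw [mul_assoc]; exact cons x hx hij (ih hjk)

theorem inv {i j : ι} {g : PushoutI φ} (hg : IsReducedProd i j g) : IsReducedProd j i g⁻¹ := by
  induction hg with
  | single x hx => rw [← map_inv]; exact single _ (by rwa [inv_mem_iff])
  | cons x hx hij _ ih =>
    rw [mul_inv_rev, ← map_inv]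
    exact ih.append hij.symm (single _ (by rwa [inv_mem_iff]))

theorem base_mul {i j : ι} {g : PushoutI φ} (hg : IsReducedProd i j g) (c : H) :
    IsReducedProd i j (base φ c * g) := by
  cases hg with
  | single x hx =>
    rw [← of_apply_eq_base φ i, ← map_mul]
    exact single _ (by rwa [Subgroup.mul_mem_cancel_left _ (MonoidHom.mem_range.mpr ⟨c, rfl⟩)])
  | cons x hx hij hg =>
    rw [← of_apply_eq_base φ i, ← mul_assoc, ← map_mul]
    exact cons _ (by rwa [Subgroup.mul_mem_cancel_left _ (MonoidHom.mem_range.mpr ⟨c, rfl⟩)]) hij hg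

theorem eq_of_or_eq_mul_of {i j : ι} {g : PushoutI φ} (hg : IsReducedProd i j g) :
    ∃ x ∉ (φ j).range, (i = j ∧ g = of j x) ∨
      ∃ k u, k ≠ j ∧ IsReducedProd i k u ∧ g = u * of j x := by
  induction hg with
  | single x hx => exact ⟨x, hx, .inl ⟨rfl, rfl⟩⟩
  | @cons i j k x hx hij g _ ih =>
    obtain ⟨y, hy, ⟨rfl, rfl⟩ | ⟨l, u, hl, hu, rfl⟩⟩ := ih
    · exact ⟨y, hy, .inr ⟨i, _, hij, single x hx, rfl⟩⟩
    · exact ⟨y, hy, .inr ⟨l, _, hl, cons x hx hij hu, (mul_assoc _ _ _).symm⟩⟩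

theorem exists_neWord {i j : ι} {g : PushoutI φ} (hg : IsReducedProd i j g) :
    ∃ w : CoprodI.NeWord G i j, Reduced φ w.toWord ∧ ofCoprodI w.prod = g := by
  induction hg with
  | @single i x hx =>
    refine ⟨.singleton x (fun h => hx (h ▸ one_mem _)), ?_, by simp⟩
    simpa [Reduced, CoprodI.NeWord.toWord] using hx
  | @cons i j k x hx hij g _ ih =>
    obtain ⟨w, hw, rfl⟩ := ih
    refine ⟨.append (.singleton x (fun h => hx (h ▸ one_mem _))) hij w, ?_, by simp⟩
    intro a ha
    rcases List.mem_cons.mp ha with rfl | ha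
    · exact hx
    · exact hw a ha

theorem ne_one (hφ : ∀ i, Function.Injective (φ i)) {i j : ι} {g : PushoutI φ}
    (hg : IsReducedProd i j g) : g ≠ 1 := by
  rintro rfl
  obtain ⟨w, hw, h⟩ := hg.exists_neWord
  have := hw.eq_empty_of_mem_range hφ (by
    change ofCoprodI w.prod ∈ _
    rw [h]; exact one_mem _)
  exact w.toList_ne_nil (congrArg CoprodI.Word.toList this)

theorem not_commute_of (hφ : ∀ i, Function.Injective (φ i)) {i j k : ι} {u : PushoutI φ}
    (hu : IsReducedProd i j u) (hik : i ≠ k) (hjk : j ≠ k) {x : G k} (hx : x ∉ (φ k).range) :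
    ¬ Commute u (of k x) := fun h => by
  have hx' : IsReducedProd k k (of (φ := φ) k x) := single x hx
  refine ne_one hφ ((hu.append hjk hx').append hjk.symm (hu.inv.append hik hx'.inv)) ?_
  rw [h.eq]
  group

theorem not_mem_center (hφ : ∀ i, Function.Injective (φ i))
    (hφ' : ∀ i, ¬ Function.Surjective (φ i)) [Nontrivial ι] {i j : ι} {g : PushoutI φ}
    (hg : IsReducedProd i j g) : g ∉ Subgroup.center (PushoutI φ) := by
  intro hc
  have hcomm (y : PushoutI φ) : Commute g y := (Subgroup.mem_center_iff.mp hc y).symm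
  by_cases hij : i = j
  · subst hij
    obtain ⟨k, hk⟩ := exists_ne i
    obtain ⟨x, hx⟩ := not_forall.mp (hφ' k)
    exact hg.not_commute_of hφ hk.symm hk.symm hx (hcomm _)
  · obtain ⟨x, hx, ⟨h, -⟩ | ⟨k, u, hk, hu, rfl⟩⟩ := hg.eq_of_or_eq_mul_of
    · exact hij h
    · refine hu.not_commute_of hφ hij hk hx ?_
      simpa using (hcomm (of j x)).mul_left (Commute.refl (of j x)).inv_left

end IsReducedProd

theorem mem_range_base_or_isReducedProd [Nonempty ι] (g : PushoutI φ) :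
    g ∈ (base φ).range ∨ ∃ i j, IsReducedProd i j g := by
  suffices h : ∀ g h : PushoutI φ, (h ∈ (base φ).range ∨ ∃ i j, IsReducedProd i j h) →
      (g * h ∈ (base φ).range ∨ ∃ i j, IsReducedProd i j (g * h)) by
    simpa only [mul_one] using h g 1 (.inl (one_mem _))
  intro g
  have hbase (c : H) (h : PushoutI φ) (hh : h ∈ (base φ).range ∨ ∃ i j, IsReducedProd i j h) :
      base φ c * h ∈ (base φ).range ∨ ∃ i j, IsReducedProd i j (base φ c * h) := by
    rcases hh with hh | ⟨i, j, hh⟩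
    · exact .inl (mul_mem ⟨c, rfl⟩ hh)
    · exact .inr ⟨i, j, hh.base_mul c⟩
  induction g using PushoutI.induction_on with
  | base c => exact hbase c
  | mul x y ihx ihy =>
    intro h hh
    rw [mul_assoc]
    exact ihx _ (ihy _ hh)
  | of i x =>
    intro h hh
    by_cases hx : x ∈ (φ i).range
    · obtain ⟨c, rfl⟩ := hx
      rw [of_apply_eq_base]
      exact hbase c h hh
    rcases hh with ⟨c, rfl⟩ | ⟨j, k, hh⟩
    · rw [← of_apply_eq_base φ i, ← map_mul]
      exact .inr ⟨i, i, .single _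
        (by rwa [Subgroup.mul_mem_cancel_right _ (MonoidHom.mem_range.mpr ⟨c, rfl⟩)])⟩
    by_cases hij : i = j
    · subst hij
      cases hh with
      | single y hy =>
        rw [← map_mul]
        by_cases hxy : x * y ∈ (φ i).range
        · obtain ⟨c, hc⟩ := hxy
          exact .inl ⟨c, by rw [← hc, of_apply_eq_base]⟩
        · exact .inr ⟨i, i, .single _ hxy⟩
      | @cons _ l _ y hy hil h hh =>
        rw [← mul_assoc, ← map_mul]
        by_cases hxy : x * y ∈ (φ i).range
        · obtain ⟨c, hc⟩ := hxy
          rw [← hc, of_apply_eq_base]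
          exact .inr ⟨l, k, hh.base_mul c⟩
        · exact .inr ⟨i, k, .cons _ hxy hil hh⟩
    · exact .inr ⟨i, k, .cons x hx hij hh⟩

/-- The center of a nondegenerate amalgamated product lies in the base group. -/
theorem center_le_range_base (hφ : ∀ i, Function.Injective (φ i))
    (hφ' : ∀ i, ¬ Function.Surjective (φ i)) [Nontrivial ι] :
    Subgroup.center (PushoutI φ) ≤ (base φ).range := fun g hg =>
  (mem_range_base_or_isReducedProd g).resolve_right fun ⟨_, _, h⟩ => h.not_mem_center hφ hφ' hg

end Monoid.PushoutI

namespace AmalgamSplitting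

open Monoid

attribute [instance] groupA groupB groupC

variable {G : Type} [Group G] (s : AmalgamSplitting G)

/-- The two factors of the splitting as a family indexed by `Bool`. -/
def factor : Bool → Type
  | true => s.A
  | false => s.B

instance : ∀ b, Group (s.factor b)
  | true => s.groupA
  | false => s.groupB

/-- The two maps from the amalgamated subgroup as a family indexed by `Bool`. -/
def incl : ∀ b, s.C →* s.factor b
  | true => s.f
  | false => s.g

theorem incl_injective : ∀ b, Function.Injective (s.incl b)
  | true => s.f_inj
  | false => s.g_inj

theorem incl_not_surjective : ∀ b, ¬ Function.Surjective (s.incl b)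
  | true => s.f_not_surj
  | false => s.g_not_surj

/-- The two maps from the factors to `G` as a family indexed by `Bool`. -/
def toGroup : ∀ b, s.factor b →* G
  | true => s.ia
  | false => s.ib

theorem toGroup_comp_incl : ∀ b, (s.toGroup b).comp (s.incl b) = s.ia.comp s.f
  | true => rfl
  | false => s.comm.symm

/-- The canonical map from the pushout of the splitting to `G`. -/
def ofPushout : PushoutI s.incl →* G :=
  PushoutI.lift s.toGroup (s.ia.comp s.f) s.toGroup_comp_incl

theorem ofPushout_comp_of (b : Bool) :
    s.ofPushout.comp (PushoutI.of (φ := s.incl) b) = s.toGroup b :=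
  MonoidHom.ext fun x => PushoutI.lift_of s.toGroup _ s.toGroup_comp_incl x

theorem exists_toPushout : ∃ h : G →* PushoutI s.incl,
    ∀ b, h.comp (s.toGroup b) = PushoutI.of (φ := s.incl) b := by
  obtain ⟨h, ha, hb⟩ :=
    (s.isPushout _ (PushoutI.of (φ := s.incl) true) (PushoutI.of (φ := s.incl) false)
      ((PushoutI.of_comp_eq_base (φ := s.incl) true).trans
        (PushoutI.of_comp_eq_base (φ := s.incl) false).symm)).exists
  exact ⟨h, fun
    | true => ha
    | false => hb⟩

theorem toGroup_injective (b : Bool) : Function.Injective (s.toGroup b) := by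
  obtain ⟨h, hh⟩ := s.exists_toPushout
  have := PushoutI.of_injective s.incl_injective b
  rw [← hh b] at this
  exact Function.Injective.of_comp this

theorem ia_injective : Function.Injective s.ia := s.toGroup_injective true

theorem ib_injective : Function.Injective s.ib := s.toGroup_injective false

theorem center_le_range : Subgroup.center G ≤ (s.ia.comp s.f).range := by
  obtain ⟨h, hh⟩ := s.exists_toPushout
  have key (b : Bool) : (s.ofPushout.comp h).comp (s.toGroup b) = s.toGroup b := by
    rw [MonoidHom.comp_assoc, hh, ofPushout_comp_of]
  have hleft : s.ofPushout.comp h = MonoidHom.id G :=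
    (s.isPushout G s.ia s.ib s.comm).unique ⟨key true, key false⟩ ⟨rfl, rfl⟩
  have hright : h.comp s.ofPushout = MonoidHom.id _ :=
    PushoutI.hom_ext_nonempty fun b => by
      rw [MonoidHom.comp_assoc, ofPushout_comp_of, hh, MonoidHom.id_comp]
  intro z hz
  have hhz : h z ∈ Subgroup.center (PushoutI s.incl) := by
    refine Subgroup.mem_center_iff.mpr fun y => ?_
    have hy : h (s.ofPushout y) = y := DFunLike.congr_fun hright y
    rw [← hy, ← map_mul, ← map_mul, Subgroup.mem_center_iff.mp hz]
  obtain ⟨c, hc⟩ := PushoutI.center_le_range_base s.incl_injective s.incl_not_surjective hhz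
  have hz' : s.ofPushout (h z) = z := DFunLike.congr_fun hleft z
  refine ⟨c, ?_⟩
  rw [← hz', ← hc]
  exact (PushoutI.lift_base _ _ s.toGroup_comp_incl c).symm

/-- The splitting of `G ⧸ Z` induced by a splitting of `G` whose amalgamated subgroup
contains `Z`. -/
def quotient (Z : Subgroup G) [Z.Normal] (hZ : Z ≤ (s.ia.comp s.f).range) :
    AmalgamSplitting (G ⧸ Z) where
  A := s.A ⧸ Z.comap s.ia
  B := s.B ⧸ Z.comap s.ib
  C := s.C ⧸ Z.comap (s.ia.comp s.f)
  f := QuotientGroup.map _ _ s.f le_rfl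
  g := QuotientGroup.map _ _ s.g (by rw [s.comm]; exact le_rfl)
  ia := QuotientGroup.map _ _ s.ia le_rfl
  ib := QuotientGroup.map _ _ s.ib le_rfl
  f_inj := by
    rw [injective_iff_map_eq_one]
    rintro ⟨c⟩ h
    exact (QuotientGroup.eq_one_iff _).mpr ((QuotientGroup.eq_one_iff (s.f c)).mp h)
  g_inj := by
    rw [injective_iff_map_eq_one]
    rintro ⟨c⟩ h
    refine (QuotientGroup.eq_one_iff _).mpr ?_
    rw [s.comm]
    exact (QuotientGroup.eq_one_iff (s.g c)).mp h
  f_not_surj := fun hs => s.f_not_surj fun a => by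
    obtain ⟨⟨c⟩, hc⟩ := hs a
    obtain ⟨d, hd⟩ := hZ (show s.ia ((s.f c)⁻¹ * a) ∈ Z from QuotientGroup.eq.mp hc)
    exact ⟨c * d, by rw [map_mul, s.ia_injective hd, mul_inv_cancel_left]⟩
  g_not_surj := fun hs => s.g_not_surj fun b => by
    obtain ⟨⟨c⟩, hc⟩ := hs b
    obtain ⟨d, hd⟩ := hZ (show s.ib ((s.g c)⁻¹ * b) ∈ Z from QuotientGroup.eq.mp hc)
    rw [s.comm] at hd
    exact ⟨c * d, by rw [map_mul, s.ib_injective hd, mul_inv_cancel_left]⟩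
  comm := by
    ext c
    exact congrArg (QuotientGroup.mk' Z) (DFunLike.congr_fun s.comm c)
  isPushout := by
    intro H _ ja jb hj
    obtain ⟨h, ⟨ha, hb⟩, huniq⟩ := s.isPushout H (ja.comp (QuotientGroup.mk' _))
      (jb.comp (QuotientGroup.mk' _))
      (MonoidHom.ext fun c => DFunLike.congr_fun hj (QuotientGroup.mk c))
    have hker : Z ≤ h.ker := by
      intro z hz
      obtain ⟨c, rfl⟩ := hZ hz
      refine (DFunLike.congr_fun ha (s.f c)).trans ?_
      rw [MonoidHom.comp_apply, QuotientGroup.mk'_apply, (QuotientGroup.eq_one_iff (s.f c)).mpr hz,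
        map_one]
    refine ⟨QuotientGroup.lift Z h hker, ⟨?_, ?_⟩, ?_⟩
    · ext a
      exact DFunLike.congr_fun ha a
    · ext b
      exact DFunLike.congr_fun hb b
    · rintro k ⟨rfl, rfl⟩
      ext x
      exact DFunLike.congr_fun (huniq (k.comp (QuotientGroup.mk' Z)) ⟨rfl, rfl⟩) x

end AmalgamSplitting

/-- Let `Z` be a central subgroup of `G`. If `G` splits as a nontrivial free product with
amalgamation `A *_C B` with `Z` contained in the image of `C`, then `G/Z` splits as a
nontrivial free product with amalgamation. Consequently, if `G/Z` does not split as a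
nontrivial free product with amalgamation, then neither does `G`. -/
theorem quotient_splits_of_central_in_amalgam
    (G : Type) [Group G] (Z : Subgroup G) (hZ : Z ≤ Subgroup.center G) :
    haveI : Z.Normal := ⟨fun z hz g => by
      rw [Subgroup.mem_center_iff.mp (hZ hz) g, mul_inv_cancel_right]; exact hz⟩
    (∀ s : AmalgamSplitting G,
        (letI := s.groupA; letI := s.groupB; letI := s.groupC;
          (Z : Set G) ⊆ Set.range (fun c => s.ia (s.f c))) →
        SplitsAsNontrivialAmalgam (G ⧸ Z)) ∧
      (¬ SplitsAsNontrivialAmalgam (G ⧸ Z) → ¬ SplitsAsNontrivialAmalgam G) := by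
  have : Z.Normal := ⟨fun z hz g => by
    rw [Subgroup.mem_center_iff.mp (hZ hz) g, mul_inv_cancel_right]; exact hz⟩
  exact ⟨fun s hs => ⟨s.quotient Z hs⟩,
    fun hn ⟨s⟩ => hn ⟨s.quotient Z (hZ.trans s.center_le_range)⟩⟩
end

section
/- The presented group G = ⟨R, P, Q : R² = 1, (QP⁻¹)⁶ = 1, (RP)³ = 1, R(QP⁻¹)R⁻¹(QP⁻¹)⁻¹ = 1, P³Q⁻² = 1⟩ has Property (FA). -/
namespace FalbelParker

/-- The generator `R` of the Falbel–Parker presentation, as an element of the free group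
on the three letters `R`, `P`, `Q`. -/
def R : FreeGroup (Fin 3) := FreeGroup.of 0

/-- The generator `P`. -/
def P : FreeGroup (Fin 3) := FreeGroup.of 1

/-- The generator `Q`. -/
def Q : FreeGroup (Fin 3) := FreeGroup.of 2

/-- The relators `R²`, `(QP⁻¹)⁶`, `(RP)³`, `[R, QP⁻¹]`, `P³Q⁻²` of the Falbel–Parker
presentation of `PU(2,1;O₃)`. -/
def rels : Set (FreeGroup (Fin 3)) :=
  {R ^ 2, (Q * P⁻¹) ^ 6, (R * P) ^ 3,
    R * (Q * P⁻¹) * R⁻¹ * (Q * P⁻¹)⁻¹, P ^ 3 * (Q ^ 2)⁻¹}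

end FalbelParker

/-- The group `⟨R, P, Q : R², (QP⁻¹)⁶, (RP)³, [R, QP⁻¹], P³Q⁻²⟩`, which by a theorem of
Falbel and Parker is isomorphic to `PU(2,1;O₃)`. -/
def FalbelParkerGroup : Type := PresentedGroup FalbelParker.rels

instance : Group FalbelParkerGroup := by unfold FalbelParkerGroup; infer_instance

namespace SimpleGraph

variable {V : Type*} {T : SimpleGraph V}

/-- `T.Between x m y` means that the vertex `m` lies on a geodesic from `x` to `y`. -/
def Between (T : SimpleGraph V) (x m y : V) : Prop :=
  T.dist x m + T.dist m y = T.dist x y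

theorem between_left (x y : V) : T.Between x x y := by simp [Between]

theorem Between.symm {x m y : V} (h : T.Between x m y) : T.Between y m x := by
  have h1 := T.dist_comm (u := x) (v := m)
  have h2 := T.dist_comm (u := m) (v := y)
  have h3 := T.dist_comm (u := x) (v := y)
  unfold Between at *
  omega

theorem Between.trans (hT : T.Connected) {x p m y : V} (hp : T.Between x p m)
    (hm : T.Between x m y) : T.Between x p y := by
  have h1 := hT.dist_triangle (u := x) (v := p) (w := y)
  have h2 := hT.dist_triangle (u := p) (v := m) (w := y)
  unfold Between at *
  omega

theorem Connected.exists_between_dist_eq (hT : T.Connected) {x y : V} {k : ℕ}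
    (hk : k ≤ T.dist x y) : ∃ m, T.Between x m y ∧ T.dist x m = k := by
  obtain ⟨p, hp⟩ := hT.exists_walk_length_eq_dist x y
  have h1 := dist_le (p.take k)
  have h2 := dist_le (p.drop k)
  have h3 := hT.dist_triangle (u := x) (v := p.getVert k) (w := y)
  rw [Walk.take_length] at h1
  rw [Walk.drop_length] at h2
  refine ⟨p.getVert k, ?_, ?_⟩ <;> grind [Between]

theorem IsTree.length_eq_dist_of_isPath (hT : T.IsTree) {x y : V} {p : T.Walk x y}
    (hp : p.IsPath) : p.length = T.dist x y := by
  obtain ⟨q, hq, hl⟩ := hT.connected.exists_path_of_dist x y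
  rw [(hT.existsUnique_path x y).unique hp hq, hl]

theorem Walk.between_of_mem_support (hT : T.Connected) {x w y : V} {p : T.Walk x y}
    (hp : p.length = T.dist x y) (hw : w ∈ p.support) : T.Between x w y := by
  classical
  have h1 := dist_le (p.takeUntil w hw)
  have h2 := dist_le (p.dropUntil w hw)
  have h3 := hT.dist_triangle (u := x) (v := w) (w := y)
  have h4 := congrArg Walk.length (p.take_spec hw)
  rw [Walk.length_append] at h4
  unfold Between
  omega

/-- If `m` is the point of a geodesic from `x` to `m` closest to `z`, then `m` lies on the
geodesic from `x` to `z`. -/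
theorem IsTree.between_of_forall_dist_le (hT : T.IsTree) {x m z : V}
    (h : ∀ w, T.Between x w m → T.dist m z ≤ T.dist w z) : T.Between x m z := by
  obtain ⟨p, hp, hpl⟩ := hT.connected.exists_path_of_dist x m
  obtain ⟨q, hq, hql⟩ := hT.connected.exists_path_of_dist m z
  have hpq : (p.append q).IsPath := by
    rw [Walk.isPath_def, Walk.support_append, List.nodup_append]
    have hqn := hq.support_nodup
    refine ⟨hp.support_nodup, hqn.tail, ?_⟩
    rintro w hw _ hw' rfl
    have h1 := h w (Walk.between_of_mem_support hT.connected hpl hw)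
    have h2 := Walk.between_of_mem_support hT.connected hql (List.mem_of_mem_tail hw')
    have hne : m ≠ w := by
      rintro rfl
      rw [← Walk.cons_tail_support] at hqn
      exact (List.nodup_cons.mp hqn).1 hw'
    have h3 := hT.connected.pos_dist_of_ne hne
    unfold Between at h2
    omega
  have := hT.length_eq_dist_of_isPath hpq
  rw [Walk.length_append] at this
  unfold Between
  omega

/-- Any three vertices of a tree have a median. -/
theorem IsTree.exists_median (hT : T.IsTree) (x y z : V) :
    ∃ m, T.Between x m y ∧ T.Between x m z ∧ T.Between y m z := by
  obtain ⟨m, hm, hmin⟩ := WellFounded.has_min (measure fun m ↦ T.dist m z).wf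
    {m | T.Between x m y} ⟨x, between_left x y⟩
  have hmin' (w : V) (hw : T.Between x w y) : T.dist m z ≤ T.dist w z := not_lt.mp (hmin w hw)
  exact ⟨m, hm,
    hT.between_of_forall_dist_le fun w hw ↦ hmin' w (hw.trans hT.connected hm),
    hT.between_of_forall_dist_le fun w hw ↦ hmin' w (hw.trans hT.connected hm.symm).symm⟩

theorem IsTree.eq_of_between (hT : T.IsTree) {x y m n : V} (hm : T.Between x m y)
    (hn : T.Between x n y) (h : T.dist x m = T.dist x n) : m = n := by
  have key (k : V) (hk : T.Between x k y) :
      ∃ p : T.Walk x y, p.IsPath ∧ p.getVert (T.dist x k) = k := by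
    obtain ⟨p, hp⟩ := hT.connected.exists_walk_length_eq_dist x k
    obtain ⟨q, hq⟩ := hT.connected.exists_walk_length_eq_dist k y
    refine ⟨p.append q, Walk.isPath_of_length_eq_dist _ ?_, ?_⟩
    · rw [Walk.length_append, hp, hq, hk]
    · simp [Walk.getVert_append, hp]
  obtain ⟨p, hp, hpm⟩ := key m hm
  obtain ⟨q, hq, hqn⟩ := key n hn
  rw [← hpm, ← hqn, (hT.existsUnique_path x y).unique hp hq, h]

theorem IsTree.between_of_dist_le (hT : T.IsTree) {x y p m : V} (hp : T.Between x p y)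
    (hm : T.Between x m y) (h : T.dist x p ≤ T.dist x m) : T.Between x p m := by
  obtain ⟨q, hq, hd⟩ := hT.connected.exists_between_dist_eq h
  rwa [hT.eq_of_between hp (hq.trans hT.connected hm) hd.symm]

/-- Overlapping geodesics in a tree concatenate to a geodesic. -/
theorem IsTree.between_concat (hT : T.IsTree) {a b c e : V} (h₁ : T.Between a b c)
    (h₂ : T.Between b c e) (hne : b ≠ c) : T.Between a c e := by
  have hc := hT.connected
  obtain ⟨m, hac, hae, hce⟩ := hT.exists_median a c e
  obtain ⟨p, hp, hpd⟩ := hc.exists_between_dist_eq (min_le_left (T.dist c m) (T.dist c b))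
  obtain ⟨q, hq, hqd⟩ := hc.exists_between_dist_eq (min_le_right (T.dist c m) (T.dist c b))
  obtain rfl := hT.eq_of_between (hp.trans hc hac.symm) (hq.trans hc h₁.symm) (hpd.trans hqd.symm)
  have hpe := hp.trans hc hce
  have h3 := hc.dist_triangle (u := b) (v := p) (w := e)
  have h4 := T.dist_comm (u := b) (v := p)
  have h5 := T.dist_comm (u := b) (v := c)
  have h6 := hc.pos_dist_of_ne hne
  have h7 : T.dist c m = 0 := by
    unfold Between at *
    omega
  rwa [hc.dist_eq_zero_iff.mp h7]

/-- Moving the endpoint `e` of a geodesic by less than the distance from `e` to `y` keeps `y` on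
the geodesic. -/
theorem IsTree.between_of_dist_lt (hT : T.IsTree) {a y e e' : V} (h : T.Between a y e)
    (hlt : T.dist e e' < T.dist y e) : T.Between a y e' := by
  obtain ⟨m, hae, hae', hee'⟩ := hT.exists_median a e e'
  refine (hT.between_of_dist_le h hae ?_).trans hT.connected hae'
  have := T.dist_comm (u := e) (v := m)
  unfold Between at *
  omega

section Action

variable {G : Type*} [Group G] [MulAction G V]

theorem Between.smul (hiso : ∀ (g : G) (u v : V), T.dist (g • u) (g • v) = T.dist u v) (g : G)
    {x m y : V} (h : T.Between x m y) : T.Between (g • x) (g • m) (g • y) := by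
  unfold Between at *
  simpa only [hiso]

/-- The fixed set of a tree automorphism is geodesically convex. -/
theorem IsTree.smul_eq_of_between (hT : T.IsTree)
    (hiso : ∀ (g : G) (u v : V), T.dist (g • u) (g • v) = T.dist u v) {g : G} {x m y : V}
    (hx : g • x = x) (hy : g • y = y) (h : T.Between x m y) : g • m = m := by
  have h1 := h.smul hiso g
  have h2 := hiso g x m
  rw [hx] at h2
  rw [hx, hy] at h1
  exact hT.eq_of_between h1 h h2

/-- If an elliptic automorphism maps `p` to `q`, then it fixes the midpoint of `p` and `q`. -/
theorem IsTree.exists_midpoint_fixed (hT : T.IsTree)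
    (hiso : ∀ (g : G) (u v : V), T.dist (g • u) (g • v) = T.dist u v) {g : G} {x p q : V}
    (hx : g • x = x) (hpq : g • p = q) :
    ∃ m, T.Between p m q ∧ T.dist p m = T.dist m q ∧ g • m = m := by
  obtain ⟨m, hm, hpx, hqx⟩ := hT.exists_median p q x
  have h1 := hpx.symm.smul hiso g
  have h2 := hiso g x m
  rw [hx] at h2
  rw [hx, hpq] at h1
  have h3 := hT.eq_of_between h1 hqx.symm h2
  have h4 := hiso g p m
  rw [hpq, h3, dist_comm] at h4
  exact ⟨m, hm, h4.symm, h3⟩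

/-- Serre's lemma: if `a`, `b` and `a * b` each fix a vertex of a tree, then `a` and `b` have a
common fixed vertex. -/
theorem IsTree.exists_common_fixed (hT : T.IsTree)
    (hiso : ∀ (g : G) (u v : V), T.dist (g • u) (g • v) = T.dist u v) {a b : G}
    (ha : ∃ x : V, a • x = x) (hb : ∃ x : V, b • x = x) (hab : ∃ x : V, (a * b) • x = x) :
    ∃ x : V, a • x = x ∧ b • x = x := by
  obtain ⟨x, hx⟩ := ha
  obtain ⟨y, hy⟩ := hb
  obtain ⟨p, hp⟩ := hab
  rw [mul_smul] at hp
  obtain ⟨m, hm, hmd, hbm⟩ := hT.exists_midpoint_fixed hiso hy (rfl : b • p = b • p)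
  obtain ⟨n, hn, hnd, han⟩ := hT.exists_midpoint_fixed hiso hx hp
  have h1 := T.dist_comm (u := p) (v := n)
  have h2 := T.dist_comm (u := b • p) (v := p)
  obtain rfl := hT.eq_of_between hm hn.symm (by unfold Between at *; omega)
  exact ⟨m, han, hbm⟩

/-- Three elliptic tree automorphisms whose fixed sets meet pairwise have a common fixed
vertex. -/
theorem IsTree.exists_common_fixed_three (hT : T.IsTree)
    (hiso : ∀ (g : G) (u v : V), T.dist (g • u) (g • v) = T.dist u v) {a b c : G}
    (hab : ∃ x : V, a • x = x ∧ b • x = x) (hac : ∃ x : V, a • x = x ∧ c • x = x)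
    (hbc : ∃ x : V, b • x = x ∧ c • x = x) :
    ∃ x : V, a • x = x ∧ b • x = x ∧ c • x = x := by
  obtain ⟨x, hxa, hxb⟩ := hab
  obtain ⟨y, hya, hyc⟩ := hac
  obtain ⟨z, hzb, hzc⟩ := hbc
  obtain ⟨m, hxy, hxz, hyz⟩ := hT.exists_median x y z
  exact ⟨m, hT.smul_eq_of_between hiso hxa hya hxy, hT.smul_eq_of_between hiso hxb hzb hxz,
    hT.smul_eq_of_between hiso hyc hzc hyz⟩

/-- A tree automorphism which, together with its powers, is not an inversion either fixes a vertex
or translates some vertex along an axis. -/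
theorem IsTree.exists_fixed_or_exists_axis (hT : T.IsTree)
    (hiso : ∀ (g : G) (u v : V), T.dist (g • u) (g • v) = T.dist u v)
    (hinv : ∀ (g : G) (u v : V), T.Adj u v → ¬(g • u = v ∧ g • v = u)) (g : G) :
    (∃ x : V, g • x = x) ∨
      ∃ (y : V) (d : ℕ), 0 < d ∧ ∀ n : ℕ, T.dist y (g ^ n • y) = n * d := by
  have hc := hT.connected
  obtain ⟨x₀⟩ := hc.nonempty
  obtain ⟨y, -, hmin⟩ := WellFounded.has_min (measure fun v ↦ T.dist v (g • v)).wf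
    Set.univ ⟨x₀, trivial⟩
  replace hmin (v : V) : T.dist y (g • y) ≤ T.dist v (g • v) := not_lt.mp (hmin v trivial)
  by_cases hy : g • y = y
  · exact .inl ⟨y, hy⟩
  have hpos := hc.pos_dist_of_ne (Ne.symm hy)
  refine .inr ⟨y, T.dist y (g • y), hpos, ?_⟩
  have hstep : T.Between y (g • y) (g • g • y) := by
    obtain ⟨m, h1, h2, h3⟩ := hT.exists_median y (g • y) (g • g • y)
    obtain h0 | h0 := (T.dist (g • y) m).eq_zero_or_pos
    · obtain rfl := hc.dist_eq_zero_iff.mp h0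
      exact h2
    obtain ⟨v, hv, hvd⟩ := hc.exists_between_dist_eq (Nat.succ_le_of_lt hpos)
    obtain ⟨u, hu, hud⟩ := hc.exists_between_dist_eq (Nat.succ_le_of_lt h0)
    have hgv : g • v = u := hT.eq_of_between (hv.smul hiso g) (hu.trans hc h3)
      (by rw [hiso, hvd, hud])
    have huy := (hu.trans hc h1.symm).symm
    have hguc := T.dist_comm (u := u) (v := g • y)
    obtain hd | hd : T.dist y (g • y) = 1 ∨ 2 ≤ T.dist y (g • y) := by omega
    · have hv' : v = g • y := hc.dist_eq_zero_iff.mp (by unfold Between at *; omega)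
      have hu' : y = u := hc.dist_eq_zero_iff.mp (by unfold Between at *; omega)
      refine absurd ⟨rfl, ?_⟩ (hinv g y (g • y) (dist_eq_one_iff_adj.mp hd))
      rw [← hv', hgv, ← hu']
    · have h4 := hT.between_of_dist_le hv huy (by unfold Between at *; omega)
      have h5 := hmin v
      rw [hgv] at h5
      unfold Between at *
      omega
  have hpow (n : ℕ) : T.Between y (g ^ n • y) (g ^ (n + 1) • y) := by
    induction n with
    | zero => simpa using between_left y (g • y)
    | succ n ih =>
      have h1 := hstep.smul hiso (g ^ n)
      simp only [← mul_smul, ← mul_assoc, ← pow_succ] at h1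
      refine hT.between_concat ih h1 fun h ↦ hy ?_
      rw [pow_succ, mul_smul] at h
      exact (smul_left_cancel _ h).symm
  intro n
  induction n with
  | zero => simp
  | succ n ih =>
    have h1 := hiso (g ^ n) y (g • y)
    rw [← mul_smul, ← pow_succ] at h1
    rw [← hpow n, ih, h1, Nat.succ_mul]

theorem IsTree.exists_fixed_of_pow_fixed (hT : T.IsTree)
    (hiso : ∀ (g : G) (u v : V), T.dist (g • u) (g • v) = T.dist u v)
    (hinv : ∀ (g : G) (u v : V), T.Adj u v → ¬(g • u = v ∧ g • v = u)) {g : G} {n : ℕ}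
    (hn : 0 < n) (h : ∃ x : V, g ^ n • x = x) : ∃ x : V, g • x = x := by
  refine (hT.exists_fixed_or_exists_axis hiso hinv g).resolve_right ?_
  rintro ⟨y, d, hd, hy⟩
  obtain ⟨x, hx⟩ := h
  have hk (k : ℕ) : g ^ (n * k) • x = x := by
    induction k with
    | zero => simp
    | succ k ih => rw [Nat.mul_succ, pow_add, mul_smul, hx, ih]
  set k := 2 * T.dist x y + 1
  have h1 := hT.connected.dist_triangle (u := y) (v := x) (w := g ^ (n * k) • y)
  have h2 := hiso (g ^ (n * k)) x y
  rw [hk] at h2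
  rw [hy, h2, T.dist_comm] at h1
  have h3 : k ≤ n * k * d := by nlinarith [Nat.mul_le_mul hn (le_refl k), Nat.zero_le k]
  omega

theorem IsTree.exists_fixed_of_pow_eq_one (hT : T.IsTree)
    (hiso : ∀ (g : G) (u v : V), T.dist (g • u) (g • v) = T.dist u v)
    (hinv : ∀ (g : G) (u v : V), T.Adj u v → ¬(g • u = v ∧ g • v = u)) {g : G} {n : ℕ}
    (hn : 0 < n) (h : g ^ n = 1) : ∃ x : V, g • x = x := by
  obtain ⟨x⟩ := hT.connected.nonempty
  exact hT.exists_fixed_of_pow_fixed hiso hinv hn ⟨x, by rw [h, one_smul]⟩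

/-- If an elliptic automorphism `a` commutes with a positive power of `g` and `g` translates `y`
along an axis, then `a` fixes `y`. -/
theorem IsTree.smul_eq_of_commute_pow (hT : T.IsTree)
    (hiso : ∀ (g : G) (u v : V), T.dist (g • u) (g • v) = T.dist u v) {a g : G} {k : ℕ}
    (hk : 0 < k) (hcomm : Commute a (g ^ k)) (ha : ∃ x : V, a • x = x) {y : V} {d : ℕ}
    (hd : 0 < d) (hy : ∀ n : ℕ, T.dist y (g ^ n • y) = n * d) : a • y = y := by
  obtain ⟨x, hx⟩ := ha
  have hfix {b : G} (hb : Commute a b) : a • b • x = b • x := by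
    rw [← mul_smul, hb.eq, mul_smul, hx]
  set n := k * (T.dist x y + 1) with hn
  have hgn : Commute a (g ^ n) := by rw [hn, pow_mul]; exact hcomm.pow_right _
  have hlt : T.dist y x < n * d := by
    rw [T.dist_comm]
    nlinarith [Nat.mul_le_mul (Nat.mul_le_mul hk (le_refl (T.dist x y + 1))) hd]
  have hback : T.dist ((g ^ n)⁻¹ • y) y = n * d := by
    rw [← hiso (g ^ n), smul_inv_smul, hy]
  have h1 : T.Between ((g ^ n)⁻¹ • y) y (g ^ n • y) := by
    rw [Between, hback, hy, ← hiso (g ^ n), smul_inv_smul, ← mul_smul, ← pow_add, hy]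
    ring
  have h2 : T.Between ((g ^ n)⁻¹ • y) y (g ^ n • x) :=
    hT.between_of_dist_lt h1 (by rwa [hiso, hy])
  have h3 : T.Between (g ^ n • x) y ((g ^ n)⁻¹ • x) :=
    hT.between_of_dist_lt h2.symm (by rwa [hiso, T.dist_comm (u := y) (v := (g ^ n)⁻¹ • y), hback])
  exact hT.smul_eq_of_between hiso (hfix hgn) (hfix hgn.inv_right) h3

/-- If `p ^ 3 = q ^ 2` and `q * p⁻¹` fixes a vertex of a tree, then so does `p`. -/
theorem IsTree.exists_fixed_of_pow_three_eq_sq (hT : T.IsTree)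
    (hiso : ∀ (g : G) (u v : V), T.dist (g • u) (g • v) = T.dist u v)
    (hinv : ∀ (g : G) (u v : V), T.Adj u v → ¬(g • u = v ∧ g • v = u)) {p q : G}
    (hpq : p ^ 3 = q ^ 2) (ha : ∃ x : V, (q * p⁻¹) • x = x) : ∃ x : V, p • x = x := by
  refine (hT.exists_fixed_or_exists_axis hiso hinv p).elim id ?_
  rintro ⟨y, d, hd, hy⟩
  have hq : Commute q (p ^ 3) := by rw [hpq]; exact Commute.self_pow q 2
  have hcomm : Commute (q * p⁻¹) (p ^ 3) := hq.mul_left (Commute.self_pow p 3).inv_left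
  have hfix (n : ℕ) : (q * p⁻¹) • p ^ n • y = p ^ n • y := by
    refine hT.smul_eq_of_commute_pow hiso three_pos hcomm ha hd fun i ↦ ?_
    rw [← mul_smul, ← pow_add, add_comm, pow_add, mul_smul, hiso, hy]
  have hqp (n : ℕ) : q • p ^ n • y = p ^ (n + 1) • y := by
    have := hfix (n + 1)
    rwa [← mul_smul, mul_assoc, pow_succ', inv_mul_cancel_left, ← pow_succ', mul_smul] at this
  have h2 : q ^ 2 • y = p ^ 2 • y := by
    have h0 := hqp 0
    rw [pow_zero, one_smul] at h0
    rw [sq, mul_smul, h0, hqp 1]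
  refine ⟨p ^ 2 • y, ?_⟩
  rw [← mul_smul, ← pow_succ', hpq, h2]

end Action

end SimpleGraph

namespace FalbelParker

/-- If a group acts without inversions on a tree and `r`, `p`, `q` satisfy the Falbel–Parker
relations, then `r`, `p`, `q` have a common fixed vertex. -/
theorem exists_common_fixed {V G : Type*} {T : SimpleGraph V} [Group G] [MulAction G V]
    (hT : T.IsTree) (hiso : ∀ (g : G) (u v : V), T.dist (g • u) (g • v) = T.dist u v)
    (hinv : ∀ (g : G) (u v : V), T.Adj u v → ¬(g • u = v ∧ g • v = u)) {r p q : G}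
    (hr : r ^ 2 = 1) (ha : (q * p⁻¹) ^ 6 = 1) (hrp : (r * p) ^ 3 = 1)
    (hcomm : r * (q * p⁻¹) * r⁻¹ * (q * p⁻¹)⁻¹ = 1) (hpq : p ^ 3 * (q ^ 2)⁻¹ = 1) :
    ∃ x : V, r • x = x ∧ p • x = x ∧ q • x = x := by
  have hpq' : p ^ 3 = q ^ 2 := mul_inv_eq_one.mp hpq
  have hra : Commute r (q * p⁻¹) := mul_inv_eq_iff_eq_mul.mp (mul_inv_eq_one.mp hcomm)
  have hra6 : (r * (q * p⁻¹)) ^ 6 = 1 := by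
    rw [hra.mul_pow, ha, mul_one, show 6 = 2 * 3 from rfl, pow_mul, hr, one_pow]
  have fr := hT.exists_fixed_of_pow_eq_one hiso hinv two_pos hr
  have fa := hT.exists_fixed_of_pow_eq_one hiso hinv (by norm_num) ha
  have frp := hT.exists_fixed_of_pow_eq_one hiso hinv three_pos hrp
  have fra := hT.exists_fixed_of_pow_eq_one hiso hinv (by norm_num) hra6
  have fp := hT.exists_fixed_of_pow_three_eq_sq hiso hinv hpq' fa
  have fq : ∃ x : V, q • x = x := by
    obtain ⟨x, hx⟩ := fp
    refine hT.exists_fixed_of_pow_fixed hiso hinv two_pos ⟨x, ?_⟩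
    rw [← hpq', pow_succ, sq, mul_smul, mul_smul, hx, hx, hx]
  obtain ⟨x, hxr, hxa, hxp⟩ := hT.exists_common_fixed_three hiso
    (hT.exists_common_fixed hiso fr fa fra) (hT.exists_common_fixed hiso fr fp frp)
    (hT.exists_common_fixed hiso fa fp (by simpa using fq))
  refine ⟨x, hxr, hxp, ?_⟩
  rw [mul_smul, inv_smul_eq_iff.mpr hxp.symm] at hxa
  exact hxa

/-- A quotient of the free group in which the Falbel–Parker relators are trivial has a fixed vertex
whenever it acts without inversions on a tree. -/
theorem exists_fixed_of_surjective {V G : Type*} {T : SimpleGraph V} [Group G] [MulAction G V]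
    (hT : T.IsTree) (hiso : ∀ (g : G) (u v : V), T.dist (g • u) (g • v) = T.dist u v)
    (hinv : ∀ (g : G) (u v : V), T.Adj u v → ¬(g • u = v ∧ g • v = u))
    {f : FreeGroup (Fin 3) →* G} (hf : Function.Surjective f) (hrel : ∀ w ∈ rels, f w = 1) :
    ∃ x : V, ∀ g : G, g • x = x := by
  simp only [rels, Set.mem_insert_iff, Set.mem_singleton_iff, forall_eq_or_imp, forall_eq,
    map_mul, map_pow, map_inv] at hrel
  obtain ⟨h1, h2, h3, h4, h5⟩ := hrel
  obtain ⟨x, hr, hp, hq⟩ := exists_common_fixed hT hiso hinv h1 h2 h3 h4 h5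
  have hgen : (MulAction.stabilizer G x).comap f = ⊤ := by
    rw [eq_top_iff, ← FreeGroup.closure_range_of, Subgroup.closure_le]
    rintro _ ⟨i, rfl⟩
    fin_cases i
    exacts [hr, hp, hq]
  refine ⟨x, fun g ↦ ?_⟩
  obtain ⟨w, rfl⟩ := hf g
  have hw : w ∈ (MulAction.stabilizer G x).comap f := hgen ▸ Subgroup.mem_top w
  exact hw

end FalbelParker

/-- The presented group `⟨R, P, Q : R², (QP⁻¹)⁶, (RP)³, [R, QP⁻¹], P³Q⁻²⟩`
(isomorphic to `PU(2,1;O₃)`) has Property (FA). -/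
theorem falbelParkerGroup_propertyFA : HasPropertyFA FalbelParkerGroup := by
  intro V T φ hconn hacyc hadj hinv
  let _ : MulAction FalbelParkerGroup V := MulAction.compHom V φ
  have hle (g : FalbelParkerGroup) (u v : V) : T.dist (g • u) (g • v) ≤ T.dist u v := by
    obtain ⟨p, hp⟩ := hconn.exists_walk_length_eq_dist u v
    let f : T →g T := ⟨φ g, fun {a b} h ↦ hadj g a b h⟩
    rw [← hp, ← p.length_map f]
    exact SimpleGraph.dist_le (p.map f)
  have hiso (g : FalbelParkerGroup) (u v : V) : T.dist (g • u) (g • v) = T.dist u v := by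
    refine (hle g u v).antisymm ?_
    simpa only [inv_smul_smul] using hle g⁻¹ (g • u) (g • v)
  exact FalbelParker.exists_fixed_of_surjective ⟨hconn, hacyc⟩ hiso hinv
    (f := PresentedGroup.mk FalbelParker.rels) (PresentedGroup.mk_surjective _)
    fun _ ↦ PresentedGroup.one_of_mem
end
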